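/- (Modified Balog–Szemerédi–Gowers) Let S ⊆ 𝔽₂^{2n} be finite nonempty with P_{s,s'∈S}[s+s' ∈ S] ≥ ε for some ε ∈ (0,1]. Then there exists a subset S' ⊆ S with |S'| ≥ (ε/(2√2))|S| and |S'+S'| ≤ 8 ε^{-6} |S'|. -/

import Mathlib

open Finset Pointwise

section SumRepresentations

variable {G : Type*} [AddCommGroup G] [DecidableEq G]

/-- The elements `y` of `S` with `x + y ∈ S`. In characteristic two its cardinality is the number of
representations of `x` as an ordered sum of two elements of `S`. -/
def sumFiber (S : Finset G) (x : G) : Finset G := S.filter (fun y => x + y ∈ S)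

lemma sum_card_sumFiber_univ [Fintype G] (S : Finset G) :
    ∑ x, ((sumFiber S x).card : ℝ) = (S.card : ℝ) ^ 2 := by
  have h (x : G) : ((sumFiber S x).card : ℝ) = ∑ y ∈ S, if x + y ∈ S then (1 : ℝ) else 0 := by
    simp [sumFiber]
  simp_rw [h]
  rw [sum_comm]
  have h2 (y : G) : ∑ x, (if x + y ∈ S then (1 : ℝ) else 0) = S.card := by
    exact (Equiv.sum_comp (Equiv.addRight y) (fun x => if x ∈ S then (1 : ℝ) else 0)).trans
      (by simp)
  simp_rw [h2]
  simp [sq]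

lemma sum_card_sumFiber (S : Finset G) :
    ∑ x ∈ S, ((sumFiber S x).card : ℝ) =
      (((S ×ˢ S).filter (fun ab => ab.1 + ab.2 ∈ S)).card : ℝ) := by
  rw [card_filter, sum_product]
  push_cast
  refine sum_congr rfl fun x _ => ?_
  simp [sumFiber]

variable [Module (ZMod 2) G]

lemma add_mem_sumFiber_add {S : Finset G} {a c x : G} (ha : a + x ∈ S) (hc : c + x ∈ S) :
    a + x ∈ sumFiber S (a + c) := by
  refine mem_filter.2 ⟨ha, ?_⟩
  have : a + c + (a + x) = (a + a) + (c + x) := by abel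
  rwa [this, ZModModule.add_self, zero_add]

lemma card_sumFiber_add_pos {S : Finset G} {a c : G} (ha : a ∈ S) (hc : c ∈ S) :
    (0 : ℝ) < (sumFiber S (a + c)).card := by
  have := add_mem_sumFiber_add (S := S) (a := a) (c := c) (x := 0) (by simpa) (by simpa)
  exact_mod_cast card_pos.2 ⟨_, this⟩

lemma sum_inv_card_sumFiber_le (S : Finset G) :
    ∑ x ∈ S, ∑ a ∈ sumFiber S x, ∑ c ∈ sumFiber S x, ((sumFiber S (a + c)).card : ℝ)⁻¹
      ≤ (S.card : ℝ) ^ 2 := by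
  have hexp (x : G) :
      ∑ a ∈ sumFiber S x, ∑ c ∈ sumFiber S x, ((sumFiber S (a + c)).card : ℝ)⁻¹ =
        ∑ a ∈ S, ∑ c ∈ S, if x + a ∈ S ∧ x + c ∈ S then
          ((sumFiber S (a + c)).card : ℝ)⁻¹ else 0 := by
    simp only [ite_and, sumFiber, sum_filter]
    refine sum_congr rfl fun a _ => ?_
    split_ifs <;> simp
  simp_rw [hexp]
  rw [sum_comm]
  have hle : ∀ a ∈ S, ∀ c ∈ S, (∑ x ∈ S, if x + a ∈ S ∧ x + c ∈ S then
      ((sumFiber S (a + c)).card : ℝ)⁻¹ else 0) ≤ 1 := by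
    intro a ha c hc
    rw [← sum_filter, sum_const, nsmul_eq_mul, ← div_eq_mul_inv,
      div_le_one (card_sumFiber_add_pos ha hc)]
    norm_cast
    refine card_le_card_of_injOn (fun x => a + x) ?_ (add_right_injective a).injOn
    intro x hx
    obtain ⟨-, h1, h2⟩ := mem_filter.1 hx
    exact add_mem_sumFiber_add (by rwa [add_comm]) (by rwa [add_comm])
  calc _ = _ := sum_congr rfl fun a _ => sum_comm
    _ ≤ ∑ a ∈ S, ∑ c ∈ S, (1 : ℝ) := sum_le_sum fun a ha => sum_le_sum fun c hc => hle a ha c hc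
    _ = (S.card : ℝ) ^ 2 := by simp [sq]

lemma three_mul_sq_le_mul_add_inv {u v k : ℝ} (hu : 0 < u) (hv : 0 < v) (hk : 0 ≤ k) :
    3 * k ^ 2 ≤ u * v + k ^ 3 * (u⁻¹ + v⁻¹) := by
  obtain ⟨p, hp, rfl⟩ : ∃ p : ℝ, 0 < p ∧ u = p ^ 2 :=
    ⟨√u, Real.sqrt_pos.2 hu, (Real.sq_sqrt hu.le).symm⟩
  obtain ⟨q, hq, rfl⟩ : ∃ q : ℝ, 0 < q ∧ v = q ^ 2 :=
    ⟨√v, Real.sqrt_pos.2 hv, (Real.sq_sqrt hv.le).symm⟩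
  have h1 : 2 * (p * q)⁻¹ ≤ (p ^ 2)⁻¹ + (q ^ 2)⁻¹ := by
    have := two_mul_le_add_sq p⁻¹ q⁻¹
    rw [mul_inv]
    simpa [mul_assoc] using this
  have h2 : 3 * k ^ 2 ≤ (p * q) ^ 2 + k ^ 3 * (2 * (p * q)⁻¹) := by
    have hm : 0 < p * q := by positivity
    generalize p * q = m at hm
    have : m ^ 2 + k ^ 3 * (2 * m⁻¹) - 3 * k ^ 2 = (m - k) ^ 2 * (m + 2 * k) / m := by
      field_simp
      ring
    have : 0 ≤ (m - k) ^ 2 * (m + 2 * k) / m := by positivity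
    linarith
  have := mul_le_mul_of_nonneg_left h1 (pow_nonneg hk 3)
  nlinarith

lemma card_pow_three_le_sq_mul_sum_mul {ι : Type*} (T : Finset ι) (u v : ι → ℝ)
    (hu : ∀ i ∈ T, 0 < u i) (hv : ∀ i ∈ T, 0 < v i) {L : ℝ} (hL : 0 < L)
    (huL : ∑ i ∈ T, (u i)⁻¹ ≤ L) (hvL : ∑ i ∈ T, (v i)⁻¹ ≤ L) :
    (T.card : ℝ) ^ 3 ≤ L ^ 2 * ∑ i ∈ T, u i * v i := by
  set k : ℝ := T.card / L with hk
  have hk0 : 0 ≤ k := by positivity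
  have hT : (T.card : ℝ) = k * L := by rw [hk]; field_simp
  clear_value k
  clear hk
  have h := sum_le_sum fun i hi => three_mul_sq_le_mul_add_inv (hu i hi) (hv i hi) hk0
  rw [sum_add_distrib, ← mul_sum T _ (k ^ 3), sum_add_distrib, sum_const, nsmul_eq_mul, hT] at h
  have h3 : k ^ 3 * (∑ i ∈ T, (u i)⁻¹ + ∑ i ∈ T, (v i)⁻¹) ≤ k ^ 3 * (L + L) := by gcongr
  have h4 : k ^ 3 * L ≤ ∑ i ∈ T, u i * v i := by linarith
  have := mul_le_mul_of_nonneg_left h4 (sq_nonneg L)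
  rw [hT]
  linarith

lemma card_add_mul_card_pow_three_le [Fintype G] {S T S' : Finset G} (hT : T ⊆ S) (hS' : S' ⊆ S)
    {L : ℝ} (hL : 0 < L)
    (h : ∀ a ∈ S', ∑ c ∈ T, ((sumFiber S (a + c)).card : ℝ)⁻¹ ≤ L) :
    ((S' + S').card : ℝ) * (T.card : ℝ) ^ 3 ≤ L ^ 2 * (S.card : ℝ) ^ 4 := by
  set r : G → ℝ := fun x => (sumFiber S x).card with hr
  have hr0 (x : G) : 0 ≤ r x := Nat.cast_nonneg _
  have hz : ∀ z ∈ S' + S', (T.card : ℝ) ^ 3 ≤ L ^ 2 * ∑ w, r w * r (z + w) := by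
    intro z hz
    obtain ⟨a, ha, b, hb, rfl⟩ := mem_add.1 hz
    refine (card_pow_three_le_sq_mul_sum_mul T (fun c => r (a + c)) (fun c => r (b + c))
      (fun c hc => card_sumFiber_add_pos (hS' ha) (hT hc))
      (fun c hc => card_sumFiber_add_pos (hS' hb) (hT hc)) hL (h a ha) (h b hb)).trans ?_
    gcongr
    have hcomp (c : G) : a + b + (a + c) = b + c := by
      have : a + b + (a + c) = (a + a) + (b + c) := by abel
      rw [this, ZModModule.add_self, zero_add]
    calc ∑ c ∈ T, r (a + c) * r (b + c)
        ≤ ∑ c, r (a + c) * r (b + c) :=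
          sum_le_univ_sum_of_nonneg fun c => mul_nonneg (hr0 _) (hr0 _)
      _ = ∑ w, r w * r (a + b + w) :=
          Fintype.sum_equiv (Equiv.addLeft a) _ _ fun c => by simp [hcomp]
  calc ((S' + S').card : ℝ) * (T.card : ℝ) ^ 3
      = ∑ z ∈ S' + S', (T.card : ℝ) ^ 3 := by simp
    _ ≤ ∑ z ∈ S' + S', L ^ 2 * ∑ w, r w * r (z + w) := sum_le_sum hz
    _ ≤ ∑ z, L ^ 2 * ∑ w, r w * r (z + w) :=
        sum_le_univ_sum_of_nonneg fun z =>
          mul_nonneg (sq_nonneg L) (sum_nonneg fun w _ => mul_nonneg (hr0 _) (hr0 _))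
    _ = L ^ 2 * (S.card : ℝ) ^ 4 := by
        rw [← mul_sum, sum_comm]
        simp_rw [← mul_sum]
        have (w : G) : ∑ z, r (z + w) = (S.card : ℝ) ^ 2 := by
          rw [← sum_card_sumFiber_univ S]
          exact Fintype.sum_equiv (Equiv.addRight w) _ _ fun z => by simp [hr]
        simp_rw [this]
        rw [← sum_mul, sum_card_sumFiber_univ S]
        ring

end SumRepresentations

lemma exists_subset_card_ge_of_sum_le {ι : Type*} (T : Finset ι) (f : ι → ℝ)
    (hf : ∀ i ∈ T, 0 ≤ f i) {m : ℝ} (hm : m < T.card) (hQ : 0 < ∑ i ∈ T, f i) :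
    ∃ T' ⊆ T, m ≤ T'.card ∧ ∀ i ∈ T', f i ≤ (∑ i ∈ T, f i) / (T.card - m) := by
  classical
  set Q := ∑ i ∈ T, f i
  have hd : 0 < T.card - m := sub_pos.2 hm
  refine ⟨T.filter (fun i => f i ≤ Q / (T.card - m)), filter_subset _ _, ?_,
    fun i hi => (mem_filter.1 hi).2⟩
  set B := T.filter (fun i => ¬ f i ≤ Q / (T.card - m))
  have hcard : ((T.filter (fun i => f i ≤ Q / (T.card - m))).card : ℝ) + B.card = T.card := by
    exact_mod_cast card_filter_add_card_filter_not _
  have h : B.card * (Q / (T.card - m)) ≤ Q := by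
    calc B.card * (Q / (T.card - m)) = ∑ i ∈ B, Q / (T.card - m) := by simp
      _ ≤ ∑ i ∈ B, f i := sum_le_sum fun i hi => (not_le.1 (mem_filter.1 hi).2).le
      _ ≤ Q := sum_le_sum_of_subset_of_nonneg (filter_subset _ _) fun i hi _ => hf i hi
  rw [← mul_div_assoc, div_le_iff₀ hd] at h
  have : (B.card : ℝ) ≤ T.card - m := by
    by_contra! hlt
    nlinarith
  linarith

lemma sq_le_two_mul_sqrt_two_mul {u : ℝ} (hu : 3 / 5 ≤ u) :
    (5 / 2 * u - 3 / 2) ^ 2 ≤ 2 * √2 * (u ^ 3 * (u - 1 / (2 * √2)) ^ 2) := by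
  have hs : √2 ^ 2 = 2 := Real.sq_sqrt (by norm_num)
  have hs0 : 0 ≤ √2 := Real.sqrt_nonneg 2
  have hs1 : 1.414213 ≤ √2 := by nlinarith
  have hs2 : √2 ≤ 1.414214 := by nlinarith
  have hc : 1 / (2 * √2) ≤ (0.3536 : ℝ) := by
    rw [div_le_iff₀ (by linarith)]
    linarith
  have h1 : (1.34 * u - 0.357) ^ 2 ≤ u ^ 3 := by
    nlinarith [mul_nonneg (by linarith : (0 : ℝ) ≤ u) (sq_nonneg (u - 0.8)), sq_nonneg (u - 0.8)]
  have h2 : (u - 0.3536) ^ 2 ≤ (u - 1 / (2 * √2)) ^ 2 := by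
    apply pow_le_pow_left₀ <;> linarith
  have h3 : (1.68 : ℝ) ^ 2 ≤ 2 * √2 := by linarith
  have h4 : 5 / 2 * u - 3 / 2 ≤ 1.68 * ((1.34 * u - 0.357) * (u - 0.3536)) := by
    nlinarith [sq_nonneg (u - 0.86)]
  calc (5 / 2 * u - 3 / 2) ^ 2
      ≤ (1.68 * ((1.34 * u - 0.357) * (u - 0.3536))) ^ 2 :=
        pow_le_pow_left₀ (by linarith) h4 2
    _ = 1.68 ^ 2 * ((1.34 * u - 0.357) ^ 2 * (u - 0.3536) ^ 2) := by ring
    _ ≤ _ := by gcongr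

/-- Modified Balog–Szemerédi–Gowers theorem: if `S ⊆ 𝔽₂^{2n}` is nonempty and
`P_{s,s'∈S}[s+s' ∈ S] ≥ ε` with `ε ∈ (0,1]`, then there is `S' ⊆ S` with
`|S'| ≥ (ε/(2√2))|S|` and `|S'+S'| ≤ 8 ε⁻⁶ |S'|`. -/
theorem modified_BSG {n : ℕ} (S : Finset (Fin (2 * n) → ZMod 2)) (hS : S.Nonempty)
    (ε : ℝ) (hε0 : 0 < ε) (hε1 : ε ≤ 1)
    (hprob : ε ≤ (((S ×ˢ S).filter (fun ab => ab.1 + ab.2 ∈ S)).card : ℝ) / (S.card : ℝ) ^ 2) :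
    ∃ S' ⊆ S, (ε / (2 * Real.sqrt 2)) * (S.card : ℝ) ≤ (S'.card : ℝ) ∧
      ((S' + S').card : ℝ) ≤ 8 * ε⁻¹ ^ 6 * (S'.card : ℝ) := by
  have hN : (0 : ℝ) < S.card := by exact_mod_cast hS.card_pos
  set N : ℝ := (S.card : ℝ) with hNdef
  rw [le_div_iff₀ (by positivity), ← sum_card_sumFiber] at hprob
  obtain ⟨x, -, hx⟩ : ∃ x ∈ S, ∑ a ∈ sumFiber S x, ∑ c ∈ sumFiber S x,
      ((sumFiber S (a + c)).card : ℝ)⁻¹ ≤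
        N * (5 / 2 * ((sumFiber S x).card / (ε * N)) - 3 / 2) := by
    refine exists_le_of_sum_le hS ((sum_inv_card_sumFiber_le S).trans ?_)
    rw [← mul_sum, sum_sub_distrib, ← mul_sum, ← sum_div, sum_const, nsmul_eq_mul, ← hNdef, sq]
    have : N ≤ (∑ x ∈ S, ((sumFiber S x).card : ℝ)) / (ε * N) := by
      rw [le_div_iff₀ (by positivity)]
      linarith
    gcongr
    linarith
  set T := sumFiber S x
  have hTS : T ⊆ S := filter_subset _ _
  set u : ℝ := T.card / (ε * N) with hu
  have hTu : (T.card : ℝ) = u * (ε * N) := by rw [hu]; field_simp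
  clear_value u
  clear hu
  set Q : ℝ := ∑ a ∈ T, ∑ c ∈ T, ((sumFiber S (a + c)).card : ℝ)⁻¹
  have hQ0 : 0 ≤ Q := sum_nonneg fun a _ => sum_nonneg fun c _ => by positivity
  have hu_ge : 3 / 5 ≤ u := by
    have := nonneg_of_mul_nonneg_right (hQ0.trans hx) hN
    linarith
  have hTne : T.Nonempty := by
    rw [← card_pos]
    have : (0 : ℝ) < T.card := by rw [hTu]; positivity
    exact_mod_cast this
  have hQpos : 0 < Q := sum_pos (fun a ha => sum_pos
    (fun c hc => inv_pos.2 (card_sumFiber_add_pos (hTS ha) (hTS hc))) hTne) hTne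
  set k : ℝ := 1 / (2 * √2) with hk
  have hk_lt : k < 3 / 5 := by
    have : 1 ≤ √2 := Real.one_le_sqrt.2 (by norm_num)
    rw [hk, div_lt_iff₀ (by positivity)]
    linarith
  have hkm : ε / (2 * √2) * N = k * (ε * N) := by rw [hk]; ring
  have hεN : 0 < ε * N := by positivity
  have hm : ε / (2 * √2) * N < T.card := by
    rw [hkm, hTu]
    gcongr
    linarith
  obtain ⟨S', hS'T, hcard, hS'⟩ := exists_subset_card_ge_of_sum_le T
    (fun a => ∑ c ∈ T, ((sumFiber S (a + c)).card : ℝ)⁻¹)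
    (fun a _ => sum_nonneg fun c _ => by positivity) hm hQpos
  refine ⟨S', hS'T.trans hTS, hcard, ?_⟩
  have hmain := card_add_mul_card_pow_three_le hTS (hS'T.trans hTS)
    (div_pos hQpos (sub_pos.2 hm)) hS'
  rw [← hNdef, hkm, hTu] at hmain
  have hQsq : Q ^ 2 ≤ N ^ 2 * (2 * √2 * (u ^ 3 * (u - k) ^ 2)) := by
    calc Q ^ 2 ≤ (N * (5 / 2 * u - 3 / 2)) ^ 2 := pow_le_pow_left₀ hQ0 hx 2
      _ = N ^ 2 * (5 / 2 * u - 3 / 2) ^ 2 := by ring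
      _ ≤ _ := by gcongr; exact sq_le_two_mul_sqrt_two_mul hu_ge
  have huk : 0 < u - k := by linarith
  have hsum : ((S' + S').card : ℝ) ≤ 2 * √2 * N / ε ^ 5 := by
    have hpos : 0 < (u * (ε * N)) ^ 3 := by positivity
    refine le_of_mul_le_mul_right (hmain.trans ?_) hpos
    have hdiff : u * (ε * N) - k * (ε * N) = (u - k) * (ε * N) := by ring
    rw [hdiff, div_pow, div_mul_eq_mul_div, div_le_iff₀ (by positivity)]
    calc Q ^ 2 * N ^ 4 ≤ N ^ 2 * (2 * √2 * (u ^ 3 * (u - k) ^ 2)) * N ^ 4 := by gcongr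
      _ = _ := by field_simp
  refine hsum.trans ?_
  calc 2 * √2 * N / ε ^ 5 = 8 * ε⁻¹ ^ 6 * (ε / (2 * √2) * N) := by
        have hs : √2 ^ 2 = 2 := Real.sq_sqrt (by norm_num)
        field_simp
        linarith
    _ ≤ _ := by gcongr
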